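/- arXiv:1211.0958 — 4 statements merged into one kernel-verified Lean document; each statement's English description precedes it below -/
import Mathlib

section
/- Two-level error estimate (main theorem). Assume the abstract QGE setup. Let X^H and X^h be closed subspaces of X, let |·|₁ be a seminorm on X, and let b0 : X × X × X → ℝ be trilinear (linear in each argument) such that b(ψ,ξ,χ) = b0(ξ,χ,ψ) − b0(χ,ξ,ψ) for all ψ, ξ, χ ∈ X, and let K ≥ 0 satisfy |b0(φ,χ,ξ)| ≤ K‖φ‖‖χ‖|ξ|₁ for all φ, χ ∈ X^h and all ξ ∈ X. Suppose ψ ∈ X satisfies a(ψ,χ) + b(ψ,ψ,χ) + c(ψ,χ) = ℓ(χ) for all χ ∈ X, ψ^H ∈ X^H satisfies a(ψ^H,χ) + b(ψ^H,ψ^H,χ) + c(ψ^H,χ) = ℓ(χ) for all χ ∈ X^H, and ψ^h ∈ X^h satisfies the linearized equation a(ψ^h,χ) + b(ψ^H,ψ^h,χ) + c(ψ^h,χ) = ℓ(χ) for all χ ∈ X^h. Then for every λ^h ∈ X^h, ‖ψ − ψ^h‖ ≤ (2 + Re·Ro⁻¹·Γ₂ + Re²·Ro⁻¹·Γ₁·Fnorm)·‖ψ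 − λ^h‖ + 2·Re²·Ro⁻¹·K·Fnorm·|ψ − ψ^H|₁. -/
theorem norm_le_of_inv_mul_sq_le {X : Type*} [SeminormedAddCommGroup X] {Re M : ℝ} (hRe : 0 < Re)
    (hM : 0 ≤ M) {x : X} (h : Re⁻¹ * ‖x‖ ^ 2 ≤ M * ‖x‖) : ‖x‖ ≤ Re * M := by
  rcases (norm_nonneg x).eq_or_lt with h0 | h0
  · rw [← h0]
    positivity
  · rw [← inv_mul_le_iff₀ hRe]
    refine le_of_mul_le_mul_right ?_ h0
    calc Re⁻¹ * ‖x‖ * ‖x‖ = Re⁻¹ * ‖x‖ ^ 2 := by ring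
      _ ≤ M * ‖x‖ := h


/-- Two-level error estimate (main theorem) for the abstract stationary QGE setup. -/
theorem two_level_error_estimate
    {X : Type*} [NormedAddCommGroup X] [InnerProductSpace ℝ X] [CompleteSpace X]
    (Re Ro Γ₁ Γ₂ Fnorm : ℝ) (hRe : 0 < Re) (hRo : 0 < Ro) (hΓ₁ : 0 < Γ₁)
    (hΓ₂ : 0 < Γ₂) (hFnorm : 0 < Fnorm)
    (a c : X →ₗ[ℝ] X →ₗ[ℝ] ℝ) (b : X →ₗ[ℝ] X →ₗ[ℝ] X →ₗ[ℝ] ℝ) (l : X →ₗ[ℝ] ℝ)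
    (ha_coerc : ∀ χ : X, a χ χ = Re⁻¹ * ‖χ‖ ^ 2)
    (ha_bdd : ∀ ψ χ : X, |a ψ χ| ≤ Re⁻¹ * ‖ψ‖ * ‖χ‖)
    (hb_bdd : ∀ ζ ψ χ : X, |b ζ ψ χ| ≤ Γ₁ * ‖ζ‖ * ‖ψ‖ * ‖χ‖)
    (hb_skew : ∀ ζ χ : X, b ζ χ χ = 0)
    (hc_bdd : ∀ ψ χ : X, |c ψ χ| ≤ Ro⁻¹ * Γ₂ * ‖ψ‖ * ‖χ‖)
    (hc_skew : ∀ χ : X, c χ χ = 0)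
    (hl_bdd : ∀ χ : X, |l χ| ≤ Ro⁻¹ * Fnorm * ‖χ‖)
    (XH Xh : Submodule ℝ X) (hXH : IsClosed (XH : Set X)) (hXh : IsClosed (Xh : Set X))
    (n1 : Seminorm ℝ X)
    (b0 : X →ₗ[ℝ] X →ₗ[ℝ] X →ₗ[ℝ] ℝ)
    (hb0_rel : ∀ ψ ξ χ : X, b ψ ξ χ = b0 ξ χ ψ - b0 χ ξ ψ)
    (K : ℝ) (hK : 0 ≤ K)
    (hb0_bdd : ∀ φ ∈ Xh, ∀ χ ∈ Xh, ∀ ξ : X, |b0 φ χ ξ| ≤ K * ‖φ‖ * ‖χ‖ * n1 ξ)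
    (ψ ψH ψh : X) (hψH_mem : ψH ∈ XH) (hψh_mem : ψh ∈ Xh)
    (hψ : ∀ χ : X, a ψ χ + b ψ ψ χ + c ψ χ = l χ)
    (hψH : ∀ χ ∈ XH, a ψH χ + b ψH ψH χ + c ψH χ = l χ)
    (hψh : ∀ χ ∈ Xh, a ψh χ + b ψH ψh χ + c ψh χ = l χ) :
    ∀ lamh ∈ Xh, ‖ψ - ψh‖ ≤
      (2 + Re * Ro⁻¹ * Γ₂ + Re ^ 2 * Ro⁻¹ * Γ₁ * Fnorm) * ‖ψ - lamh‖ +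
      2 * Re ^ 2 * Ro⁻¹ * K * Fnorm * n1 (ψ - ψH) := by
  intro lamh hlamh
  have stability : ∀ ζ u : X, a u u + b ζ u u + c u u = l u → ‖u‖ ≤ Re * (Ro⁻¹ * Fnorm) := by
    intro ζ u hu
    rw [ha_coerc, hb_skew, hc_skew, add_zero, add_zero] at hu
    exact norm_le_of_inv_mul_sq_le hRe (by positivity) (hu.trans_le ((le_abs_self _).trans (hl_bdd u)))
  have hψ_norm := stability ψ ψ (hψ ψ)
  have hψh_norm := stability ψH ψh (hψh ψh hψh_mem)
  set η := ψ - lamh with hη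
  set φ := ψh - lamh with hφ
  have hφ_mem : φ ∈ Xh := Xh.sub_mem hψh_mem hlamh
  have hn1 : 0 ≤ n1 (ψ - ψH) := apply_nonneg n1 _
  have error_eq : a φ φ = a η φ + b (ψ - ψH) ψh φ + b ψ η φ + c η φ := by
    have h1 := hψ φ
    have h2 := hψh φ hφ_mem
    have h3 := hb_skew ψ φ
    have h4 := hc_skew φ
    have eψ : ψ = η + lamh := by simp [hη]
    have eψh : ψh = φ + lamh := by simp [hφ]
    have ea : a ψ φ - a ψh φ = a η φ - a φ φ := by
      rw [eψ, eψh]; simp only [map_add, LinearMap.add_apply]; ring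
    have ec : c ψ φ - c ψh φ = c η φ - c φ φ := by
      rw [eψ, eψh]; simp only [map_add, LinearMap.add_apply]; ring
    have eb : b ψ ψ φ - b ψ ψh φ = b ψ η φ - b ψ φ φ := by
      rw [← LinearMap.sub_apply, ← LinearMap.sub_apply, ← map_sub, ← map_sub, hη, hφ,
        sub_sub_sub_cancel_right]
    have ed : b (ψ - ψH) ψh φ = b ψ ψh φ - b ψH ψh φ := by
      simp only [map_sub b, LinearMap.sub_apply]
    linarith
  have hb_coarse : |b (ψ - ψH) ψh φ| ≤ 2 * K * ‖ψh‖ * ‖φ‖ * n1 (ψ - ψH) := by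
    rw [hb0_rel]
    have h1 := hb0_bdd ψh hψh_mem φ hφ_mem (ψ - ψH)
    have h2 := hb0_bdd φ hφ_mem ψh hψh_mem (ψ - ψH)
    linarith [abs_sub (b0 ψh φ (ψ - ψH)) (b0 φ ψh (ψ - ψH))]
  have hφ_norm : ‖φ‖ ≤ Re * (Re⁻¹ * ‖η‖ + 2 * K * (Re * (Ro⁻¹ * Fnorm)) * n1 (ψ - ψH)
      + Γ₁ * (Re * (Ro⁻¹ * Fnorm)) * ‖η‖ + Ro⁻¹ * Γ₂ * ‖η‖) := by
    refine norm_le_of_inv_mul_sq_le hRe (by positivity) ?_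
    rw [← ha_coerc, error_eq]
    have h1 := (le_abs_self _).trans (ha_bdd η φ)
    have h2 : b (ψ - ψH) ψh φ ≤ 2 * K * (Re * (Ro⁻¹ * Fnorm)) * ‖φ‖ * n1 (ψ - ψH) :=
      (le_abs_self _).trans (hb_coarse.trans (by gcongr))
    have h3 : b ψ η φ ≤ Γ₁ * (Re * (Ro⁻¹ * Fnorm)) * ‖η‖ * ‖φ‖ :=
      (le_abs_self _).trans ((hb_bdd ψ η φ).trans (by gcongr))
    have h4 := (le_abs_self _).trans (hc_bdd η φ)
    linarith
  calc ‖ψ - ψh‖ = ‖η - φ‖ := by rw [hη, hφ, sub_sub_sub_cancel_right]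
    _ ≤ ‖η‖ + ‖φ‖ := norm_sub_le _ _
    _ ≤ ‖η‖ + _ := add_le_add le_rfl hφ_norm
    _ = _ := by field_simp; ring
end

section
/- One-level (coarse mesh) error estimate. Assume the abstract QGE setup and the small data condition Re⁻¹ − Γ₁·Re·Ro⁻¹·Fnorm > 0. Let X^H be a closed subspace of X. Suppose ψ ∈ X satisfies a(ψ,χ) + b(ψ,ψ,χ) + c(ψ,χ) = ℓ(χ) for all χ ∈ X, and ψ^H ∈ X^H satisfies a(ψ^H,χ) + b(ψ^H,ψ^H,χ) + c(ψ^H,χ) = ℓ(χ) for all χ ∈ X^H. Then for every χ^H ∈ X^H, ‖ψ − ψ^H‖ ≤ C·‖ψ − χ^H‖, where C = (Γ₂·Ro⁻¹ + 2·Re⁻¹ + Γ₁·Re·Ro⁻¹·Fnorm)/(Re⁻¹ − Γ₁·Re·Ro⁻¹·Fnorm). -/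
/-- If `k⁻¹ * x ^ 2 ≤ m * x` with `k > 0` and `m, x ≥ 0`, then `x ≤ k * m`. -/
lemma le_mul_of_inv_mul_sq_le {k m x : ℝ} (hk : 0 < k) (hm : 0 ≤ m) (hx : 0 ≤ x)
    (h : k⁻¹ * x ^ 2 ≤ m * x) : x ≤ k * m := by
  rcases hx.eq_or_lt with rfl | hx
  · positivity
  · rw [← inv_mul_le_iff₀ hk]
    exact le_of_mul_le_mul_right (by linarith) hx

/-- One-level (coarse mesh) error estimate for the abstract stationary QGE setup. -/
theorem one_level_error_estimate
    {X : Type*} [NormedAddCommGroup X] [InnerProductSpace ℝ X] [CompleteSpace X]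
    (Re Ro Γ₁ Γ₂ Fnorm : ℝ) (hRe : 0 < Re) (hRo : 0 < Ro) (hΓ₁ : 0 < Γ₁)
    (hΓ₂ : 0 < Γ₂) (hFnorm : 0 < Fnorm)
    (a c : X →ₗ[ℝ] X →ₗ[ℝ] ℝ) (b : X →ₗ[ℝ] X →ₗ[ℝ] X →ₗ[ℝ] ℝ) (l : X →ₗ[ℝ] ℝ)
    (ha_coerc : ∀ χ : X, a χ χ = Re⁻¹ * ‖χ‖ ^ 2)
    (ha_bdd : ∀ ψ χ : X, |a ψ χ| ≤ Re⁻¹ * ‖ψ‖ * ‖χ‖)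
    (hb_bdd : ∀ ζ ψ χ : X, |b ζ ψ χ| ≤ Γ₁ * ‖ζ‖ * ‖ψ‖ * ‖χ‖)
    (hb_skew : ∀ ζ χ : X, b ζ χ χ = 0)
    (hc_bdd : ∀ ψ χ : X, |c ψ χ| ≤ Ro⁻¹ * Γ₂ * ‖ψ‖ * ‖χ‖)
    (hc_skew : ∀ χ : X, c χ χ = 0)
    (hl_bdd : ∀ χ : X, |l χ| ≤ Ro⁻¹ * Fnorm * ‖χ‖)
    (hsmall : 0 < Re⁻¹ - Γ₁ * Re * Ro⁻¹ * Fnorm)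
    (XH : Submodule ℝ X) (hXH : IsClosed (XH : Set X))
    (ψ ψH : X) (hψH_mem : ψH ∈ XH)
    (hψ : ∀ χ : X, a ψ χ + b ψ ψ χ + c ψ χ = l χ)
    (hψH : ∀ χ ∈ XH, a ψH χ + b ψH ψH χ + c ψH χ = l χ) :
    ∀ χH ∈ XH, ‖ψ - ψH‖ ≤
      (Γ₂ * Ro⁻¹ + 2 * Re⁻¹ + Γ₁ * Re * Ro⁻¹ * Fnorm) /
        (Re⁻¹ - Γ₁ * Re * Ro⁻¹ * Fnorm) * ‖ψ - χH‖ := by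
  intro χH hχH
  have energy : ∀ φ : X, a φ φ + b φ φ φ + c φ φ = l φ → ‖φ‖ ≤ Re * (Ro⁻¹ * Fnorm) := by
    intro φ hφ
    rw [ha_coerc, hb_skew, hc_skew, add_zero, add_zero] at hφ
    exact le_mul_of_inv_mul_sq_le hRe (by positivity) (norm_nonneg φ)
      (hφ.le.trans ((le_abs_self _).trans (hl_bdd φ)))
  have hψ_norm := energy ψ (hψ ψ)
  have hψH_norm := energy ψH (hψH ψH hψH_mem)
  set M := Re * (Ro⁻¹ * Fnorm) with hM
  have hM_eq : Γ₁ * Re * Ro⁻¹ * Fnorm = Γ₁ * M := by rw [hM]; ring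
  rw [hM_eq] at hsmall ⊢
  set e := ψ - ψH with he
  set η := ψ - χH with hη
  have hmem : e - η ∈ XH := by
    have : e - η = χH - ψH := by rw [he, hη]; abel
    exact this ▸ XH.sub_mem hχH hψH_mem
  have horth : a e e + b e ψ e + b ψH e e + c e e =
      a e η + b e ψ η + b ψH e η + c e η := by
    have h₁ := hψ (e - η)
    have h₂ := hψH (e - η) hmem
    have hψ_eq : ψ = ψH + e := by rw [he]; abel
    clear_value e η
    subst hψ_eq
    simp only [map_add, map_sub, LinearMap.add_apply] at h₁ h₂ ⊢
    linarith
  rw [ha_coerc, hb_skew, hc_skew] at horth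
  have hbe : |b e ψ e| ≤ Γ₁ * M * ‖e‖ ^ 2 :=
    calc |b e ψ e| ≤ Γ₁ * ‖e‖ * ‖ψ‖ * ‖e‖ := hb_bdd e ψ e
      _ ≤ Γ₁ * ‖e‖ * M * ‖e‖ := by gcongr
      _ = Γ₁ * M * ‖e‖ ^ 2 := by ring
  have hbψ : |b e ψ η| ≤ Γ₁ * M * (‖e‖ * ‖η‖) :=
    calc |b e ψ η| ≤ Γ₁ * ‖e‖ * ‖ψ‖ * ‖η‖ := hb_bdd e ψ η
      _ ≤ Γ₁ * ‖e‖ * M * ‖η‖ := by gcongr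
      _ = Γ₁ * M * (‖e‖ * ‖η‖) := by ring
  have hbψH : |b ψH e η| ≤ Γ₁ * M * (‖e‖ * ‖η‖) :=
    calc |b ψH e η| ≤ Γ₁ * ‖ψH‖ * ‖e‖ * ‖η‖ := hb_bdd ψH e η
      _ ≤ Γ₁ * M * ‖e‖ * ‖η‖ := by gcongr
      _ = Γ₁ * M * (‖e‖ * ‖η‖) := by ring
  have hsq : (Re⁻¹ - Γ₁ * M) * ‖e‖ * ‖e‖ ≤
      (Γ₂ * Ro⁻¹ + Re⁻¹ + 2 * (Γ₁ * M)) * ‖η‖ * ‖e‖ := by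
    linarith [neg_le_of_abs_le hbe, le_of_abs_le hbψ, le_of_abs_le hbψH,
      le_of_abs_le (ha_bdd e η), le_of_abs_le (hc_bdd e η)]
  rw [div_mul_eq_mul_div, le_div_iff₀ hsmall, mul_comm]
  rcases (norm_nonneg e).eq_or_lt with he₀ | he₀
  · rw [← he₀, mul_zero]
    have : 0 < M := by positivity
    positivity
  · calc (Re⁻¹ - Γ₁ * M) * ‖e‖ ≤ (Γ₂ * Ro⁻¹ + Re⁻¹ + 2 * (Γ₁ * M)) * ‖η‖ :=
          le_of_mul_le_mul_right hsq he₀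
      _ ≤ (Γ₂ * Ro⁻¹ + 2 * Re⁻¹ + Γ₁ * M) * ‖η‖ := by
          gcongr ?_ * ‖η‖
          linarith
end

section
/- Continuity of the QGE trilinear form. Let Ω ⊆ ℝ² be a bounded open set. There exists a constant Γ₁ > 0 (depending only on Ω) such that for all smooth functions ζ, ψ, χ : ℝ² → ℝ with compact support contained in Ω, |∫_{ℝ²} Δζ·(ψ_y·χ_x − ψ_x·χ_y)| ≤ Γ₁·‖D²ζ‖_{L²}·‖D²ψ‖_{L²}·‖D²χ‖_{L²}. -/
open MeasureTheory

/-- Partial derivative in the first coordinate direction. -/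
noncomputable def pdx (f : ℝ × ℝ → ℝ) (p : ℝ × ℝ) : ℝ := fderiv ℝ f p (1, 0)

/-- Partial derivative in the second coordinate direction. -/
noncomputable def pdy (f : ℝ × ℝ → ℝ) (p : ℝ × ℝ) : ℝ := fderiv ℝ f p (0, 1)

/-- Laplacian Δf = f_xx + f_yy. -/
noncomputable def lap (f : ℝ × ℝ → ℝ) (p : ℝ × ℝ) : ℝ := pdx (pdx f) p + pdy (pdy f) p

/-- Squared Frobenius norm of the Hessian: f_xx² + 2 f_xy² + f_yy². -/
noncomputable def hessSq (f : ℝ × ℝ → ℝ) (p : ℝ × ℝ) : ℝ :=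
  pdx (pdx f) p ^ 2 + 2 * pdx (pdy f) p ^ 2 + pdy (pdy f) p ^ 2

/-- H² seminorm: ‖D²f‖_{L²}. -/
noncomputable def seminormH2 (f : ℝ × ℝ → ℝ) : ℝ := Real.sqrt (∫ p, hessSq f p)

/-- H¹ seminorm: ‖∇f‖_{L²}. -/
noncomputable def seminormH1 (f : ℝ × ℝ → ℝ) : ℝ :=
  Real.sqrt (∫ p, (pdx f p ^ 2 + pdy f p ^ 2))

/-- L² norm. -/
noncomputable def normL2 (g : ℝ × ℝ → ℝ) : ℝ := Real.sqrt (∫ p, g p ^ 2)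

open scoped ENNReal NNReal

lemma ContDiff.pdx {f : ℝ × ℝ → ℝ} (hf : ContDiff ℝ (⊤ : ℕ∞) f) :
    ContDiff ℝ (⊤ : ℕ∞) (pdx f) :=
  (hf.fderiv_right (m := (⊤ : ℕ∞)) (by simp)).clm_apply contDiff_const

lemma ContDiff.pdy {f : ℝ × ℝ → ℝ} (hf : ContDiff ℝ (⊤ : ℕ∞) f) :
    ContDiff ℝ (⊤ : ℕ∞) (pdy f) :=
  (hf.fderiv_right (m := (⊤ : ℕ∞)) (by simp)).clm_apply contDiff_const

lemma HasCompactSupport.pdx {f : ℝ × ℝ → ℝ} (hf : HasCompactSupport f) :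
    HasCompactSupport (pdx f) :=
  hf.fderiv_apply ℝ (1, 0)

lemma HasCompactSupport.pdy {f : ℝ × ℝ → ℝ} (hf : HasCompactSupport f) :
    HasCompactSupport (pdy f) :=
  hf.fderiv_apply ℝ (0, 1)

lemma HasCompactSupport.fun_sq {f : ℝ × ℝ → ℝ} (hf : HasCompactSupport f) :
    HasCompactSupport fun p => f p ^ 2 :=
  hf.comp_left (g := fun t : ℝ => t ^ 2) (by simp)

lemma pdy_pdx_eq_pdx_pdy {f : ℝ × ℝ → ℝ} (hf : ContDiff ℝ (⊤ : ℕ∞) f) (p : ℝ × ℝ) :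
    pdy (pdx f) p = pdx (pdy f) p := by
  have hd : DifferentiableAt ℝ (fderiv ℝ f) p :=
    (hf.fderiv_right (m := (⊤ : ℕ∞)) (by simp)).differentiable (by simp) p
  have hs : IsSymmSndFDerivAt ℝ f p :=
    (contDiff_infty.1 hf 2).contDiffAt.isSymmSndFDerivAt (by simp)
  have key (v w : ℝ × ℝ) :
      fderiv ℝ (fun q => fderiv ℝ f q v) p w = fderiv ℝ (fderiv ℝ f) p w v := by
    rw [fderiv_clm_apply hd (differentiableAt_const v)]
    simp
  change fderiv ℝ (fun q => fderiv ℝ f q (1, 0)) p (0, 1) =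
    fderiv ℝ (fun q => fderiv ℝ f q (0, 1)) p (1, 0)
  rw [key, key]
  exact hs.eq _ _

lemma norm_fderiv_sq_le (u : ℝ × ℝ → ℝ) (p : ℝ × ℝ) :
    ‖fderiv ℝ u p‖ ^ 2 ≤ 2 * (pdx u p ^ 2 + pdy u p ^ 2) := by
  have h : ‖fderiv ℝ u p‖ ≤ |pdx u p| + |pdy u p| := by
    refine ContinuousLinearMap.opNorm_le_bound _ (by positivity) fun v => ?_
    have hv : v = v.1 • ((1, 0) : ℝ × ℝ) + v.2 • ((0, 1) : ℝ × ℝ) := by ext <;> simp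
    have h1 : |v.1| ≤ ‖v‖ := norm_fst_le v
    have h2 : |v.2| ≤ ‖v‖ := norm_snd_le v
    calc ‖fderiv ℝ u p v‖ = |v.1 * pdx u p + v.2 * pdy u p| := by
          conv_lhs => rw [hv]
          simp only [map_add, map_smul, smul_eq_mul, Real.norm_eq_abs, pdx, pdy]
      _ ≤ |v.1| * |pdx u p| + |v.2| * |pdy u p| := by
          simpa only [abs_mul] using abs_add_le (v.1 * pdx u p) (v.2 * pdy u p)
      _ ≤ ‖v‖ * |pdx u p| + ‖v‖ * |pdy u p| := by gcongr
      _ = (|pdx u p| + |pdy u p|) * ‖v‖ := by ring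
  calc ‖fderiv ℝ u p‖ ^ 2 ≤ (|pdx u p| + |pdy u p|) ^ 2 := by gcongr
    _ ≤ 2 * (|pdx u p| ^ 2 + |pdy u p| ^ 2) := by nlinarith [sq_nonneg (|pdx u p| - |pdy u p|)]
    _ = _ := by simp only [sq_abs]

/-- Cauchy–Schwarz for continuous compactly supported functions. -/
lemma sq_integral_mul_le {f g : ℝ × ℝ → ℝ} (hf : Continuous f) (hf' : HasCompactSupport f)
    (hg : Continuous g) (hg' : HasCompactSupport g) :
    (∫ p, f p * g p) ^ 2 ≤ (∫ p, f p ^ 2) * ∫ p, g p ^ 2 := by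
  have h := integral_mul_norm_le_Lp_mul_Lq (μ := (volume : Measure (ℝ × ℝ)))
    Real.HolderConjugate.two_two (hf.memLp_of_hasCompactSupport hf')
    (hg.memLp_of_hasCompactSupport hg')
  simp only [Real.rpow_two, Real.norm_eq_abs, sq_abs, ← Real.sqrt_eq_rpow] at h
  have h' : |∫ p, f p * g p| ≤ √(∫ p, f p ^ 2) * √(∫ p, g p ^ 2) := by
    refine abs_integral_le_integral_abs.trans ?_
    simpa only [abs_mul] using h
  calc (∫ p, f p * g p) ^ 2 = |∫ p, f p * g p| ^ 2 := (sq_abs _).symm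
    _ ≤ (√(∫ p, f p ^ 2) * √(∫ p, g p ^ 2)) ^ 2 := by gcongr
    _ = _ := by
      rw [mul_pow, Real.sq_sqrt (integral_nonneg fun _ => sq_nonneg _),
        Real.sq_sqrt (integral_nonneg fun _ => sq_nonneg _)]

/-- The Sobolev embedding of `H¹₀` into `L⁴` on bounded subsets of the plane. -/
lemma exists_eLpNorm_four_le {s : Set (ℝ × ℝ)} (hs : Bornology.IsBounded s) :
    ∃ C : ℝ≥0, ∀ u : ℝ × ℝ → ℝ, ContDiff ℝ 1 u → tsupport u ⊆ s →
      eLpNorm u 4 volume ≤ C * eLpNorm (fderiv ℝ u) 2 volume := by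
  refine ⟨eLpNormLESNormFDerivOfLeConst ℝ (volume : Measure (ℝ × ℝ)) s (4 / 3) 4 *
    ((volume s).toNNReal ^ (1 / 4 : ℝ)), fun u hu hus => ?_⟩
  have hfin : Module.finrank ℝ (ℝ × ℝ) = 2 := by simp
  have h1 := eLpNorm_le_eLpNorm_fderiv_of_le (volume : Measure (ℝ × ℝ)) (p := 4 / 3) (q := 4) hu
    ((subset_tsupport u).trans hus)
    (by rw [← NNReal.coe_le_coe]; norm_num) (by rw [hfin, ← NNReal.coe_lt_coe]; norm_num)
    (by rw [hfin]; norm_num) hs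
  have hsupp : Function.support (fderiv ℝ u) ⊆ s := (support_fderiv_subset ℝ).trans hus
  have h2 := eLpNorm_le_eLpNorm_mul_rpow_measure_univ (μ := volume.restrict s)
    (p := ((4 / 3 : ℝ≥0) : ℝ≥0∞)) (q := ((2 : ℝ≥0) : ℝ≥0∞)) (f := fderiv ℝ u)
    (by rw [ENNReal.coe_le_coe, ← NNReal.coe_le_coe]; norm_num)
    (hu.continuous_fderiv (by simp)).aestronglyMeasurable
  have hr (p : ℝ≥0∞) :
      eLpNorm (fderiv ℝ u) p (volume.restrict s) = eLpNorm (fderiv ℝ u) p volume := by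
    rw [← eLpNorm_norm, ← eLpNorm_norm (fderiv ℝ u)]
    exact eLpNorm_restrict_eq_of_support_subset
      ((Function.support_comp_subset norm_zero (fderiv ℝ u)).trans hsupp)
  rw [hr, hr] at h2
  have hexp : (1 / ((4 / 3 : ℝ≥0) : ℝ≥0∞).toReal - 1 / ((2 : ℝ≥0) : ℝ≥0∞).toReal : ℝ) = 1 / 4 := by
    rw [ENNReal.coe_toReal, ENNReal.coe_toReal]; norm_num
  have hvol : ((volume s).toNNReal : ℝ≥0∞) = volume s :=
    ENNReal.coe_toNNReal hs.measure_lt_top.ne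
  have c4 : ((4 : ℝ≥0) : ℝ≥0∞) = 4 := by norm_num
  have c2 : ((2 : ℝ≥0) : ℝ≥0∞) = 2 := by norm_num
  rw [hexp, Measure.restrict_apply_univ, c2] at h2
  rw [c4] at h1
  rw [ENNReal.coe_mul, ENNReal.coe_rpow_of_nonneg _ (by norm_num), hvol, mul_assoc,
    mul_comm (volume s ^ _)]
  exact h1.trans (mul_le_mul_right h2 _)

lemma exists_integral_pow_four_le {s : Set (ℝ × ℝ)} (hs : Bornology.IsBounded s) :
    ∃ C : ℝ, 0 < C ∧ ∀ u : ℝ × ℝ → ℝ, ContDiff ℝ (⊤ : ℕ∞) u → HasCompactSupport u →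
      tsupport u ⊆ s → ∫ p, u p ^ 4 ≤ C * (∫ p, (pdx u p ^ 2 + pdy u p ^ 2)) ^ 2 := by
  obtain ⟨C, hC⟩ := exists_eLpNorm_four_le hs
  refine ⟨4 * (C : ℝ) ^ 4 + 1, by positivity, fun u hu huc hus => ?_⟩
  have hu1 : ContDiff ℝ 1 u := hu.of_le (by exact_mod_cast le_top)
  have h := hC u hu1 hus
  have hcf : Continuous (fderiv ℝ u) := hu1.continuous_fderiv (by simp)
  rw [(hu.continuous.memLp_of_hasCompactSupport huc).eLpNorm_eq_integral_rpow_norm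
      (by simp) (by simp),
    (hcf.memLp_of_hasCompactSupport (huc.fderiv ℝ)).eLpNorm_eq_integral_rpow_norm
      (by simp) (by simp), ← ENNReal.ofReal_coe_nnreal, ← ENNReal.ofReal_mul (by positivity),
    ENNReal.ofReal_le_ofReal_iff (by positivity)] at h
  have e4 : (4 : ℝ≥0∞).toReal = ((4 : ℕ) : ℝ) := by simp
  have e2 : (2 : ℝ≥0∞).toReal = ((2 : ℕ) : ℝ) := by simp
  simp only [e4, e2, Real.rpow_natCast] at h
  have hI4 : 0 ≤ ∫ p, ‖u p‖ ^ 4 := by positivity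
  have hI2 : 0 ≤ ∫ p, ‖fderiv ℝ u p‖ ^ 2 := by positivity
  have h4 := pow_le_pow_left₀ (by positivity) h 4
  have hg : Continuous fun p => pdx u p ^ 2 + pdy u p ^ 2 :=
    (hu.pdx.continuous.pow 2).add (hu.pdy.continuous.pow 2)
  have hgc : HasCompactSupport fun p => pdx u p ^ 2 + pdy u p ^ 2 := by
    refine HasCompactSupport.add ?_ ?_
    · exact huc.pdx.fun_sq
    · exact huc.pdy.fun_sq
  have hle : ∫ p, ‖fderiv ℝ u p‖ ^ 2 ≤ 2 * ∫ p, (pdx u p ^ 2 + pdy u p ^ 2) := by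
    rw [← integral_const_mul]
    refine integral_mono_of_nonneg (ae_of_all _ fun _ => by positivity)
      ((hg.integrable_of_hasCompactSupport hgc).const_mul 2) (ae_of_all _ (norm_fderiv_sq_le u))
  rw [Real.rpow_inv_natCast_pow hI4 (by simp), mul_pow,
    show (4 : ℕ) = 2 * 2 from rfl, pow_mul ((∫ p, ‖fderiv ℝ u p‖ ^ 2) ^ _),
    Real.rpow_inv_natCast_pow hI2 (by simp)] at h4
  calc ∫ p, u p ^ 4 = ∫ p, ‖u p‖ ^ 4 := by
        simp only [Real.norm_eq_abs, Even.pow_abs (by decide : Even 4)]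
    _ ≤ (C : ℝ) ^ 4 * (∫ p, ‖fderiv ℝ u p‖ ^ 2) ^ 2 := h4
    _ ≤ (C : ℝ) ^ 4 * (2 * ∫ p, (pdx u p ^ 2 + pdy u p ^ 2)) ^ 2 := by gcongr
    _ ≤ _ := by nlinarith [sq_nonneg (∫ p, (pdx u p ^ 2 + pdy u p ^ 2))]

lemma hessSq_nonneg (f : ℝ × ℝ → ℝ) (p : ℝ × ℝ) : 0 ≤ hessSq f p := by
  unfold hessSq; positivity

lemma integral_hessSq_nonneg (f : ℝ × ℝ → ℝ) : 0 ≤ ∫ p, hessSq f p :=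
  integral_nonneg (hessSq_nonneg f)

lemma seminormH2_sq (f : ℝ × ℝ → ℝ) : seminormH2 f ^ 2 = ∫ p, hessSq f p :=
  Real.sq_sqrt (integral_hessSq_nonneg f)

lemma integrable_hessSq {f : ℝ × ℝ → ℝ} (hf : ContDiff ℝ (⊤ : ℕ∞) f)
    (hc : HasCompactSupport f) : Integrable (hessSq f) := by
  refine Continuous.integrable_of_hasCompactSupport ?_ ?_
  · exact ((hf.pdx.pdx.continuous.pow 2).add
      (continuous_const.mul (hf.pdy.pdx.continuous.pow 2))).add (hf.pdy.pdy.continuous.pow 2)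
  · refine HasCompactSupport.add (HasCompactSupport.add ?_ ?_) ?_
    · exact hc.pdx.pdx.fun_sq
    · exact hc.pdy.pdx.comp_left (g := fun t : ℝ => 2 * t ^ 2) (by simp)
    · exact hc.pdy.pdy.fun_sq

/-- The first derivatives of an `H²₀` function on a bounded set are controlled in `L⁴`. -/
lemma exists_integral_pd_pow_four_le {s : Set (ℝ × ℝ)} (hs : Bornology.IsBounded s) :
    ∃ C : ℝ, 0 < C ∧ ∀ f : ℝ × ℝ → ℝ, ContDiff ℝ (⊤ : ℕ∞) f → HasCompactSupport f →
      tsupport f ⊆ s → ∫ p, pdx f p ^ 4 ≤ C * (∫ p, hessSq f p) ^ 2 ∧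
        ∫ p, pdy f p ^ 4 ≤ C * (∫ p, hessSq f p) ^ 2 := by
  obtain ⟨C, hC0, hC⟩ := exists_integral_pow_four_le hs
  refine ⟨C, hC0, fun f hf hc hfs => ⟨?_, ?_⟩⟩
  · refine (hC _ hf.pdx hc.pdx ((tsupport_fderiv_apply_subset ℝ _).trans hfs)).trans ?_
    refine mul_le_mul_of_nonneg_left (pow_le_pow_left₀ (by positivity) ?_ 2) hC0.le
    refine integral_mono_of_nonneg (ae_of_all _ fun _ => by positivity)
      (integrable_hessSq hf hc) (ae_of_all _ fun p => ?_)
    simp only [pdy_pdx_eq_pdx_pdy hf, hessSq]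
    nlinarith [sq_nonneg (pdx (pdy f) p), sq_nonneg (pdy (pdy f) p)]
  · refine (hC _ hf.pdy hc.pdy ((tsupport_fderiv_apply_subset ℝ _).trans hfs)).trans ?_
    refine mul_le_mul_of_nonneg_left (pow_le_pow_left₀ (by positivity) ?_ 2) hC0.le
    refine integral_mono_of_nonneg (ae_of_all _ fun _ => by positivity)
      (integrable_hessSq hf hc) (ae_of_all _ fun p => ?_)
    simp only [hessSq]
    nlinarith [sq_nonneg (pdx (pdy f) p), sq_nonneg (pdx (pdx f) p)]

lemma integral_sq_mul_sq_le {f g : ℝ × ℝ → ℝ} (hf : Continuous f) (hf' : HasCompactSupport f)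
    (hg : Continuous g) (hg' : HasCompactSupport g) {C A B : ℝ} (hC : 0 ≤ C) (hA : 0 ≤ A)
    (hB : 0 ≤ B) (hfA : ∫ p, f p ^ 4 ≤ C * A ^ 2) (hgB : ∫ p, g p ^ 4 ≤ C * B ^ 2) :
    ∫ p, f p ^ 2 * g p ^ 2 ≤ C * A * B := by
  have h := sq_integral_mul_le (f := fun p => f p ^ 2) (g := fun p => g p ^ 2)
    (hf.pow 2) hf'.fun_sq (hg.pow 2) hg'.fun_sq
  simp only [← pow_mul, Nat.reduceMul] at h
  refine le_of_sq_le_sq ?_ (by positivity)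
  calc (∫ p, f p ^ 2 * g p ^ 2) ^ 2 ≤ (∫ p, f p ^ 4) * ∫ p, g p ^ 4 := h
    _ ≤ (C * A ^ 2) * (C * B ^ 2) := by gcongr
    _ = (C * A * B) ^ 2 := by ring

lemma integral_lap_sq_le {f : ℝ × ℝ → ℝ} (hf : ContDiff ℝ (⊤ : ℕ∞) f)
    (hc : HasCompactSupport f) : ∫ p, lap f p ^ 2 ≤ 2 * ∫ p, hessSq f p := by
  rw [← integral_const_mul]
  refine integral_mono_of_nonneg (ae_of_all _ fun _ => by positivity)
    ((integrable_hessSq hf hc).const_mul 2) (ae_of_all _ fun p => ?_)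
  simp only [lap, hessSq]
  nlinarith [sq_nonneg (pdx (pdx f) p - pdy (pdy f) p), sq_nonneg (pdx (pdy f) p)]

/-- Continuity of the QGE trilinear form b(ζ;ψ,χ) = ∫ Δζ (ψ_y χ_x − ψ_x χ_y). -/
theorem trilinear_form_continuity (Ω : Set (ℝ × ℝ)) (hΩo : IsOpen Ω)
    (hΩb : Bornology.IsBounded Ω) :
    ∃ Γ₁ : ℝ, 0 < Γ₁ ∧ ∀ ζ ψ χ : ℝ × ℝ → ℝ,
      ContDiff ℝ (⊤ : ℕ∞) ζ → ContDiff ℝ (⊤ : ℕ∞) ψ → ContDiff ℝ (⊤ : ℕ∞) χ →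
      HasCompactSupport ζ → HasCompactSupport ψ → HasCompactSupport χ →
      tsupport ζ ⊆ Ω → tsupport ψ ⊆ Ω → tsupport χ ⊆ Ω →
      |∫ p, lap ζ p * (pdy ψ p * pdx χ p - pdx ψ p * pdy χ p)| ≤
        Γ₁ * seminormH2 ζ * seminormH2 ψ * seminormH2 χ := by
  obtain ⟨C, hC0, hC⟩ := exists_integral_pd_pow_four_le hΩb
  refine ⟨√(8 * C), by positivity, fun ζ ψ χ hζ hψ hχ cζ cψ cχ _ sψ sχ => ?_⟩
  obtain ⟨hψx, hψy⟩ := hC ψ hψ cψ sψ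
  obtain ⟨hχx, hχy⟩ := hC χ hχ cχ sχ
  have nζ := integral_hessSq_nonneg ζ
  have nψ := integral_hessSq_nonneg ψ
  have nχ := integral_hessSq_nonneg χ
  have h1 := integral_sq_mul_sq_le hψ.pdy.continuous cψ.pdy hχ.pdx.continuous cχ.pdx hC0.le
    nψ nχ hψy hχx
  have h2 := integral_sq_mul_sq_le hψ.pdx.continuous cψ.pdx hχ.pdy.continuous cχ.pdy hC0.le
    nψ nχ hψx hχy
  have int_sq_mul_sq {f g : ℝ × ℝ → ℝ} (hf : Continuous f) (hf' : HasCompactSupport f)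
      (hg : Continuous g) : Integrable fun p => f p ^ 2 * g p ^ 2 :=
    ((hf.pow 2).mul (hg.pow 2)).integrable_of_hasCompactSupport
      hf'.fun_sq.mul_right
  have i1 := int_sq_mul_sq hψ.pdy.continuous cψ.pdy hχ.pdx.continuous
  have i2 := int_sq_mul_sq hψ.pdx.continuous cψ.pdx hχ.pdy.continuous
  have hJ : ∫ p, (pdy ψ p * pdx χ p - pdx ψ p * pdy χ p) ^ 2 ≤
      4 * (C * (∫ p, hessSq ψ p) * ∫ p, hessSq χ p) := by
    calc ∫ p, (pdy ψ p * pdx χ p - pdx ψ p * pdy χ p) ^ 2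
        ≤ ∫ p, 2 * (pdy ψ p ^ 2 * pdx χ p ^ 2 + pdx ψ p ^ 2 * pdy χ p ^ 2) := by
          refine integral_mono_of_nonneg (ae_of_all _ fun _ => by positivity)
            ((i1.add i2).const_mul 2) (ae_of_all _ fun p => ?_)
          simp only
          nlinarith [sq_nonneg (pdy ψ p * pdx χ p + pdx ψ p * pdy χ p)]
      _ ≤ _ := by
          rw [integral_const_mul, integral_add i1 i2]
          linarith
  have hCS := sq_integral_mul_le (f := lap ζ)
    (g := fun p => pdy ψ p * pdx χ p - pdx ψ p * pdy χ p)
    (hζ.pdx.pdx.continuous.add hζ.pdy.pdy.continuous) (cζ.pdx.pdx.add cζ.pdy.pdy)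
    ((hψ.pdy.continuous.mul hχ.pdx.continuous).sub (hψ.pdx.continuous.mul hχ.pdy.continuous))
    ((HasCompactSupport.mul_right cψ.pdy).sub (HasCompactSupport.mul_right cψ.pdx))
  have sn (f : ℝ × ℝ → ℝ) : 0 ≤ seminormH2 f := Real.sqrt_nonneg _
  refine abs_le_of_sq_le_sq ?_
    (mul_nonneg (mul_nonneg (mul_nonneg (Real.sqrt_nonneg _) (sn ζ)) (sn ψ)) (sn χ))
  calc (∫ p, lap ζ p * (pdy ψ p * pdx χ p - pdx ψ p * pdy χ p)) ^ 2
      ≤ (∫ p, lap ζ p ^ 2) * ∫ p, (pdy ψ p * pdx χ p - pdx ψ p * pdy χ p) ^ 2 := hCS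
    _ ≤ (2 * ∫ p, hessSq ζ p) * (4 * (C * (∫ p, hessSq ψ p) * ∫ p, hessSq χ p)) := by
        gcongr
        exact integral_lap_sq_le hζ cζ
    _ = _ := by
        simp only [mul_pow, seminormH2_sq, Real.sq_sqrt (by positivity : 0 ≤ 8 * C)]
        ring
end

section
/- Stability estimate for the stationary QGE weak solution. Let Ω ⊆ ℝ² be a bounded open set, Re > 0, Ro > 0, M ≥ 0, and let F : ℝ² → ℝ be continuous. Suppose ψ : ℝ² → ℝ is smooth with compact support contained in Ω and satisfies, for every smooth χ : ℝ² → ℝ with compact support contained in Ω, the weak formulation Re⁻¹·∫_{ℝ²} Δψ·Δχ + ∫_{ℝ²} Δψ·(ψ_y·χ_x − ψ_x·χ_y) − Ro⁻¹·∫_{ℝ²} ψ_x·χ = Ro⁻¹·∫_{ℝ²} F·χ, and suppose the forcing satisfies |∫_{ℝ²} F·χ| ≤ M·‖Δχ‖_{L²} for every such χ. Then ‖Δψ‖_{L²} ≤ Re·Ro⁻¹·M. -/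
open MeasureTheory

/-- A compactly supported smooth function is `L²`-orthogonal to its first partial derivative. -/
theorem integral_pdx_mul_self_eq_zero {f : ℝ × ℝ → ℝ} (hf : ContDiff ℝ (⊤ : ℕ∞) f)
    (hfc : HasCompactSupport f) : ∫ p, pdx f p * f p = 0 := by
  have hcont : Continuous fun p => fderiv ℝ f p (1, 0) :=
    (hf.continuous_fderiv (by simp)).clm_apply continuous_const
  have hdiff : Differentiable ℝ f := hf.differentiable (by simp)
  have hparts := integral_mul_fderiv_eq_neg_fderiv_mul_of_integrable
    (μ := (volume : Measure (ℝ × ℝ))) (f := f) (g := f) (v := ((1, 0) : ℝ × ℝ))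
    ((hcont.mul hf.continuous).integrable_of_hasCompactSupport hfc.mul_left)
    ((hf.continuous.mul hcont).integrable_of_hasCompactSupport hfc.mul_right)
    ((hf.continuous.mul hf.continuous).integrable_of_hasCompactSupport hfc.mul_left)
    (fun p _ => hdiff p) (fun p _ => hdiff p)
  have hcomm : ∫ p, f p * fderiv ℝ f p (1, 0) = ∫ p, fderiv ℝ f p (1, 0) * f p := by
    simp only [mul_comm]
  simp only [pdx]
  linarith

/-- The square of the `L²` norm is the integral of the square. -/
theorem normL2_sq (g : ℝ × ℝ → ℝ) : normL2 g ^ 2 = ∫ p, g p * g p := by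
  rw [normL2, Real.sq_sqrt (integral_nonneg fun p => sq_nonneg (g p))]
  simp only [sq]

/-- Stability estimate for the stationary QGE weak solution: ‖Δψ‖_{L²} ≤ Re Ro⁻¹ M. -/
theorem sqge_stability (Ω : Set (ℝ × ℝ)) (hΩo : IsOpen Ω) (hΩb : Bornology.IsBounded Ω)
    (Re Ro M : ℝ) (hRe : 0 < Re) (hRo : 0 < Ro) (hM : 0 ≤ M)
    (F : ℝ × ℝ → ℝ) (hF : Continuous F)
    (ψ : ℝ × ℝ → ℝ) (hψ : ContDiff ℝ (⊤ : ℕ∞) ψ) (hψc : HasCompactSupport ψ)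
    (hψΩ : tsupport ψ ⊆ Ω)
    (hweak : ∀ χ : ℝ × ℝ → ℝ, ContDiff ℝ (⊤ : ℕ∞) χ → HasCompactSupport χ → tsupport χ ⊆ Ω →
      Re⁻¹ * (∫ p, lap ψ p * lap χ p) +
        (∫ p, lap ψ p * (pdy ψ p * pdx χ p - pdx ψ p * pdy χ p)) -
        Ro⁻¹ * (∫ p, pdx ψ p * χ p) = Ro⁻¹ * ∫ p, F p * χ p)
    (hFbound : ∀ χ : ℝ × ℝ → ℝ, ContDiff ℝ (⊤ : ℕ∞) χ → HasCompactSupport χ → tsupport χ ⊆ Ω →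
      |∫ p, F p * χ p| ≤ M * normL2 (lap χ)) :
    normL2 (lap ψ) ≤ Re * Ro⁻¹ * M := by
  have henergy := hweak ψ hψ hψc hψΩ
  have hforce := hFbound ψ hψ hψc hψΩ
  have hadv : ∫ p, lap ψ p * (pdy ψ p * pdx ψ p - pdx ψ p * pdy ψ p) = 0 := by
    simp [mul_comm]
  rw [hadv, integral_pdx_mul_self_eq_zero hψ hψc, ← normL2_sq, mul_zero, add_zero,
    sub_zero] at henergy
  have hN : 0 ≤ normL2 (lap ψ) := Real.sqrt_nonneg _
  rcases hN.eq_or_lt with h0 | hpos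
  · rw [← h0]
    positivity
  · refine le_of_mul_le_mul_right ?_ hpos
    calc normL2 (lap ψ) * normL2 (lap ψ) = Re * (Re⁻¹ * normL2 (lap ψ) ^ 2) := by
          field_simp
      _ = Re * Ro⁻¹ * ∫ p, F p * ψ p := by rw [henergy, mul_assoc]
      _ ≤ Re * Ro⁻¹ * (M * normL2 (lap ψ)) := by
          gcongr
          exact (le_abs_self _).trans hforce
      _ = Re * Ro⁻¹ * M * normL2 (lap ψ) := by ring
end
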